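/- Let n ≥ 1 and let γ satisfy: γ > 1/2 if n = 1, γ > 0 if n = 2, γ ≥ 0 if n ≥ 3. Then there exists a constant C > 0 such that for every u₁ ∈ L^{1,γ}(ℝⁿ) and every t > 0, ( ∫_{|ξ|≤1} | E₁(t,ξ) û₁(ξ) − Σ_{k=0}^{⌊γ⌋} e₁^k(t,ξ) ( Σ_{j=0}^{⌊γ⌋−k} m[u₁]^j(ξ) ) |² dξ )^{1/2} ≤ C ‖u₁‖_{1,γ} (1+t)^{−n/4−γ/2+1/2}. -/

import Mathlib

open MeasureTheory Filter

noncomputable section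

/-- Euclidean space `ℝⁿ`. -/
abbrev Rn (n : ℕ) := EuclideanSpace ℝ (Fin n)

/-- Fourier transform `f̂(ξ) = ∫ e^{-i x·ξ} f(x) dx` of a real-valued `f`. -/
def fourierHat (n : ℕ) (f : Rn n → ℝ) (ξ : Rn n) : ℂ :=
  ∫ x : Rn n, Complex.exp (-Complex.I * ((∑ i, x i * ξ i : ℝ) : ℂ)) * (f x : ℂ)

/-- Membership in the weighted space `L^{1,γ}(ℝⁿ)`. -/
def MemL1w (n : ℕ) (γ : ℝ) (f : Rn n → ℝ) : Prop :=
  MeasureTheory.Integrable f ∧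
    MeasureTheory.Integrable (fun x : Rn n => (1 + ‖x‖) ^ γ * |f x|)

/-- The weighted norm `‖f‖_{1,γ}`. -/
def wnorm (n : ℕ) (γ : ℝ) (f : Rn n → ℝ) : ℝ :=
  ∫ x : Rn n, (1 + ‖x‖) ^ γ * |f x|

/-- The evolution operator multiplier `E₀(t,ξ)`. -/
def E0 (n : ℕ) (t : ℝ) (ξ : Rn n) : ℝ :=
  if ‖ξ‖ ≤ 2 then
    Real.exp (-(t * ‖ξ‖ ^ 2) / 2) * Real.cos (t * ‖ξ‖ * Real.sqrt (4 - ‖ξ‖ ^ 2) / 2)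
  else
    Real.exp (-(t * ‖ξ‖ ^ 2) / 2) * Real.cosh (t * ‖ξ‖ * Real.sqrt (‖ξ‖ ^ 2 - 4) / 2)

/-- The evolution operator multiplier `E₁(t,ξ)`. -/
def E1 (n : ℕ) (t : ℝ) (ξ : Rn n) : ℝ :=
  if ‖ξ‖ ≤ 2 then
    Real.exp (-(t * ‖ξ‖ ^ 2) / 2) *
      (Real.sin (t * ‖ξ‖ * Real.sqrt (4 - ‖ξ‖ ^ 2) / 2) /
        (‖ξ‖ * Real.sqrt (4 - ‖ξ‖ ^ 2) / 2))
  else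
    Real.exp (-(t * ‖ξ‖ ^ 2) / 2) *
      (Real.sinh (t * ‖ξ‖ * Real.sqrt (‖ξ‖ ^ 2 - 4) / 2) /
        (‖ξ‖ * Real.sqrt (‖ξ‖ ^ 2 - 4) / 2))

/-- `L₀(a,t,ξ)` as a function of `a`. -/
def L0fun (n : ℕ) (t : ℝ) (ξ : Rn n) (a : ℝ) : ℝ :=
  Real.cos (t * ‖ξ‖ - t * ‖ξ‖ ^ 2 * (a / (4 + 2 * Real.sqrt (4 - a ^ 2))))

/-- `L₁(a,t,ξ)` as a function of `a`. -/
def L1fun (n : ℕ) (t : ℝ) (ξ : Rn n) (a : ℝ) : ℝ :=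
  Real.sin (t * ‖ξ‖ - t * ‖ξ‖ ^ 2 * (a / (4 + 2 * Real.sqrt (4 - a ^ 2)))) /
    (‖ξ‖ * Real.sqrt (4 - a ^ 2) / 2)

/-- `e₀^k(t,ξ) = e^{-t|ξ|²/2} (1/k!) (∂^k L₀/∂a^k)(0,t,ξ) |ξ|^k`. -/
def e0 (n : ℕ) (k : ℕ) (t : ℝ) (ξ : Rn n) : ℝ :=
  Real.exp (-(t * ‖ξ‖ ^ 2) / 2) * ((1 : ℝ) / k.factorial) *
    iteratedDeriv k (L0fun n t ξ) 0 * ‖ξ‖ ^ k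

/-- `e₁^k(t,ξ) = e^{-t|ξ|²/2} (1/k!) (∂^k L₁/∂a^k)(0,t,ξ) |ξ|^k`. -/
def e1 (n : ℕ) (k : ℕ) (t : ℝ) (ξ : Rn n) : ℝ :=
  Real.exp (-(t * ‖ξ‖ ^ 2) / 2) * ((1 : ℝ) / k.factorial) *
    iteratedDeriv k (L1fun n t ξ) 0 * ‖ξ‖ ^ k

/-- The moment polynomial
`m[f]^k(ξ) = ∑_{|α|=k} ((-1)^{|α|}/α!) (∫ x^α f(x) dx) (iξ)^α`. -/
def mom (n : ℕ) (f : Rn n → ℝ) (k : ℕ) (ξ : Rn n) : ℂ :=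
  ∑ α ∈ Finset.univ.filter (fun α : Fin n → Fin (k + 1) => ∑ i, (α i).val = k),
    ((-1 : ℂ) ^ k / ∏ i, ((α i).val.factorial : ℂ)) *
      ((∫ x : Rn n, (∏ i, x i ^ (α i).val) * f x : ℝ) : ℂ) *
      ∏ i, (Complex.I * (ξ i : ℂ)) ^ (α i).val

/-- The Fourier-space solution of the strongly damped wave equation. -/
def uhat (n : ℕ) (u₀ u₁ : Rn n → ℝ) (t : ℝ) (ξ : Rn n) : ℂ :=
  (E0 n t ξ : ℂ) * fourierHat n u₀ ξ +
    (E1 n t ξ : ℂ) * (((‖ξ‖ ^ 2 / 2 : ℝ) : ℂ) * fourierHat n u₀ ξ + fourierHat n u₁ ξ)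

/-- Derivatives in `a` of the oscillating function `sin (θ - s φ(a)) g(a)` grow at most
polynomially in the frequency `s`, uniformly in the phase `θ`. -/
lemma exists_abs_iteratedDerivWithin_sin_sub_mul_le {K : Set ℝ} (hK : IsCompact K)
    (hK' : UniqueDiffOn ℝ K) {φ : ℝ → ℝ} (hφ : ContDiffOn ℝ (⊤ : ℕ∞) φ K) (k : ℕ) :
    ∀ g : ℝ → ℝ, ContDiffOn ℝ (⊤ : ℕ∞) g K →
      ∃ C : ℝ, 0 ≤ C ∧ ∀ s : ℝ, 0 ≤ s → ∀ θ : ℝ, ∀ a ∈ K,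
        |iteratedDerivWithin k (fun a => Real.sin (θ - s * φ a) * g a) K a| ≤ C * (1 + s) ^ k := by
  induction k with
  | zero =>
    intro g hg
    obtain ⟨C, hC⟩ := hK.exists_bound_of_continuousOn hg.continuousOn
    refine ⟨|C|, abs_nonneg _, fun s _ θ a ha => ?_⟩
    rw [iteratedDerivWithin_zero, pow_zero, mul_one, abs_mul]
    calc |Real.sin (θ - s * φ a)| * |g a| ≤ 1 * |g a| := by
          gcongr
          exact Real.abs_sin_le_one _
      _ ≤ |C| := by
          rw [one_mul]
          exact (hC a ha).trans (le_abs_self C)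
  | succ k ih =>
    intro g hg
    have hφ' : ContDiffOn ℝ (⊤ : ℕ∞) (derivWithin φ K) K :=
      hφ.derivWithin hK' (by simp)
    have hg' : ContDiffOn ℝ (⊤ : ℕ∞) (derivWithin g K) K :=
      hg.derivWithin hK' (by simp)
    obtain ⟨C₁, hC₁, h₁⟩ := ih _ hg'
    obtain ⟨C₂, hC₂, h₂⟩ := ih _ (hφ'.mul hg)
    refine ⟨C₁ + C₂, by positivity, fun s hs θ a ha => ?_⟩
    have hsm : ∀ (θ' : ℝ) (h : ℝ → ℝ), ContDiffOn ℝ (⊤ : ℕ∞) h K →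
        ContDiffOn ℝ k (fun a => Real.sin (θ' - s * φ a) * h a) K := fun θ' h hh =>
      (((contDiffOn_const.sub (contDiffOn_const.mul hφ)).sin).mul hh).of_le
        (by exact_mod_cast le_top)
    have hderiv : Set.EqOn (derivWithin (fun a => Real.sin (θ - s * φ a) * g a) K)
        (fun a => Real.sin (θ - s * φ a) * derivWithin g K a +
          (-s) * (Real.sin (θ + Real.pi / 2 - s * φ a) * (derivWithin φ K a * g a))) K := by
      intro b hb
      have h1 : HasDerivWithinAt φ (derivWithin φ K b) K b :=
        ((hφ.differentiableOn (by simp)) b hb).hasDerivWithinAt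
      have h2 : HasDerivWithinAt g (derivWithin g K b) K b :=
        ((hg.differentiableOn (by simp)) b hb).hasDerivWithinAt
      have h3 := ((((h1.const_mul s).const_sub θ).sin).mul h2).derivWithin (hK' b hb)
      have h4 : Real.sin (θ + Real.pi / 2 - s * φ b) = Real.cos (θ - s * φ b) := by
        rw [← Real.sin_add_pi_div_two]
        ring_nf
      simp only [h4]
      refine h3.trans ?_
      ring
    rw [iteratedDerivWithin_succ', iteratedDerivWithin_congr hderiv ha,
      iteratedDerivWithin_fun_add ha hK' (hsm θ _ hg' a ha)
        (contDiffWithinAt_const.mul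
          (hsm _ (fun a => derivWithin φ K a * g a) (hφ'.mul hg) a ha)),
      iteratedDerivWithin_const_mul_field]
    calc _ ≤ C₁ * (1 + s) ^ k + s * (C₂ * (1 + s) ^ k) := by
          refine (abs_add_le _ _).trans (add_le_add (h₁ s hs θ a ha) ?_)
          rw [abs_mul, abs_neg, abs_of_nonneg hs]
          exact mul_le_mul_of_nonneg_left (h₂ s hs _ a ha) hs
      _ ≤ C₁ * ((1 + s) ^ k * (1 + s)) + (1 + s) * (C₂ * (1 + s) ^ k) := by
          have : 0 ≤ (1 + s) ^ k := by positivity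
          have : 0 ≤ (1 + s) ^ k * s := by positivity
          gcongr
          · linarith
          · linarith
      _ = (C₁ + C₂) * (1 + s) ^ (k + 1) := by ring

lemma contDiffAt_phase {a : ℝ} (ha : a ^ 2 < 4) {m : WithTop ℕ∞} :
    ContDiffAt ℝ m (fun a : ℝ => a / (4 + 2 * Real.sqrt (4 - a ^ 2))) a := by
  have h : (4 : ℝ) - a ^ 2 ≠ 0 := by linarith
  refine contDiffAt_id.div (contDiffAt_const.add (contDiffAt_const.mul
    ((contDiffAt_const.sub (contDiffAt_id.pow 2)).sqrt h))) ?_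
  positivity

lemma contDiffAt_amplitude {a : ℝ} (ha : a ^ 2 < 4) {m : WithTop ℕ∞} :
    ContDiffAt ℝ m (fun a : ℝ => (Real.sqrt (4 - a ^ 2) / 2)⁻¹) a := by
  have h : (0 : ℝ) < 4 - a ^ 2 := by linarith
  have h' := Real.sqrt_pos.2 h
  exact (((contDiffAt_const.sub (contDiffAt_id.pow 2)).sqrt h.ne').div_const 2).inv
    (by simpa using h'.ne')

lemma L1fun_eq (n : ℕ) (t : ℝ) (ξ : Rn n) :
    L1fun n t ξ = fun a => ‖ξ‖⁻¹ * (Real.sin (t * ‖ξ‖ - t * ‖ξ‖ ^ 2 *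
      (a / (4 + 2 * Real.sqrt (4 - a ^ 2)))) * (Real.sqrt (4 - a ^ 2) / 2)⁻¹) := by
  funext a
  rw [L1fun, mul_div_assoc, div_eq_mul_inv, mul_inv]
  ring

lemma contDiffAt_L1fun (n : ℕ) (t : ℝ) (ξ : Rn n) {a : ℝ} (ha : a ^ 2 < 4) {m : WithTop ℕ∞} :
    ContDiffAt ℝ m (L1fun n t ξ) a := by
  rw [L1fun_eq]
  exact contDiffAt_const.mul (((contDiffAt_const.sub
    (contDiffAt_const.mul (contDiffAt_phase ha))).sin).mul (contDiffAt_amplitude ha))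

lemma E1_eq_exp_mul_L1fun (n : ℕ) (t : ℝ) {ξ : Rn n} (hξ : ‖ξ‖ ≤ 2) :
    E1 n t ξ = Real.exp (-(t * ‖ξ‖ ^ 2) / 2) * L1fun n t ξ ‖ξ‖ := by
  rw [E1, if_pos hξ, L1fun]
  have h : 0 ≤ 4 - ‖ξ‖ ^ 2 := by nlinarith [norm_nonneg ξ]
  have hs := Real.sq_sqrt h
  have hs' := Real.sqrt_nonneg (4 - ‖ξ‖ ^ 2)
  generalize Real.sqrt (4 - ‖ξ‖ ^ 2) = q at *
  congr 3
  field_simp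
  linear_combination (2 * t * ‖ξ‖) * hs

lemma sq_lt_four_of_mem_Icc {a : ℝ} (ha : a ∈ Set.Icc (0 : ℝ) 1) : a ^ 2 < 4 := by
  nlinarith [ha.1, ha.2]

lemma exists_abs_iteratedDerivWithin_L1fun_le (k : ℕ) :
    ∃ C : ℝ, 0 ≤ C ∧ ∀ (n : ℕ) (t : ℝ), 0 ≤ t → ∀ ξ : Rn n, ∀ a ∈ Set.Icc (0 : ℝ) 1,
      |iteratedDerivWithin k (L1fun n t ξ) (Set.Icc 0 1) a| ≤
        ‖ξ‖⁻¹ * (C * (1 + t * ‖ξ‖ ^ 2) ^ k) := by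
  obtain ⟨C, hC, h⟩ := exists_abs_iteratedDerivWithin_sin_sub_mul_le isCompact_Icc
    (uniqueDiffOn_Icc zero_lt_one)
    (fun a ha => (contDiffAt_phase (sq_lt_four_of_mem_Icc ha)).contDiffWithinAt) k _
    (fun a ha => (contDiffAt_amplitude (sq_lt_four_of_mem_Icc ha)).contDiffWithinAt)
  refine ⟨C, hC, fun n t ht ξ a ha => ?_⟩
  rw [L1fun_eq, iteratedDerivWithin_const_mul_field, abs_mul, abs_inv, abs_norm]
  exact mul_le_mul_of_nonneg_left (h _ (by positivity) _ a ha) (by positivity)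

lemma exists_one_add_pow_mul_exp_le (k : ℕ) :
    ∃ C : ℝ, 0 ≤ C ∧ ∀ s : ℝ, 0 ≤ s → Real.exp (-s / 2) * (1 + s) ^ k ≤ C * Real.exp (-s / 4) := by
  refine ⟨4 ^ k * k.factorial * Real.exp (1 / 4), by positivity, fun s hs => ?_⟩
  have h := Real.pow_div_factorial_le_exp ((1 + s) / 4) (by positivity) k
  rw [div_pow, div_div, div_le_iff₀ (by positivity)] at h
  calc Real.exp (-s / 2) * (1 + s) ^ k
      ≤ Real.exp (-s / 2) * (Real.exp ((1 + s) / 4) * (4 ^ k * k.factorial)) := by gcongr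
    _ = 4 ^ k * k.factorial * Real.exp (1 / 4) * Real.exp (-s / 4) := by
        rw [mul_assoc _ (Real.exp (1 / 4)), ← Real.exp_add, ← mul_assoc, ← Real.exp_add, mul_comm]
        ring_nf

lemma exists_abs_E1_sub_sum_e1_le (M : ℕ) :
    ∃ C : ℝ, 0 ≤ C ∧ ∀ (n : ℕ) (t : ℝ), 0 ≤ t → ∀ ξ : Rn n, ‖ξ‖ ≤ 1 →
      |E1 n t ξ - ∑ k ∈ Finset.range M, e1 n k t ξ| ≤
        C * Real.exp (-(t * ‖ξ‖ ^ 2) / 4) * ‖ξ‖ ^ M * ‖ξ‖⁻¹ := by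
  obtain ⟨C₁, hC₁, h₁⟩ := exists_abs_iteratedDerivWithin_L1fun_le M
  obtain ⟨C₂, hC₂, h₂⟩ := exists_one_add_pow_mul_exp_le M
  refine ⟨C₁ * C₂, by positivity, fun n t ht ξ hξ => ?_⟩
  have hmem : ‖ξ‖ ∈ Set.Icc (0 : ℝ) 1 := ⟨norm_nonneg _, hξ⟩
  have htaylor : |L1fun n t ξ ‖ξ‖ - ∑ k ∈ Finset.range M,
      (1 : ℝ) / k.factorial * iteratedDeriv k (L1fun n t ξ) 0 * ‖ξ‖ ^ k| ≤
      ‖ξ‖⁻¹ * (C₁ * (1 + t * ‖ξ‖ ^ 2) ^ M) * ‖ξ‖ ^ M := by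
    cases M with
    | zero => simpa using h₁ n t ht ξ _ hmem
    | succ m =>
      have hsm : ContDiffOn ℝ (m + 1) (L1fun n t ξ) (Set.Icc 0 1) := fun a ha =>
        (contDiffAt_L1fun n t ξ (sq_lt_four_of_mem_Icc ha)).contDiffWithinAt
      have h := taylor_mean_remainder_bound zero_le_one hsm hmem (h₁ n t ht ξ)
      rw [taylor_within_apply, sub_zero, Real.norm_eq_abs] at h
      have heq : ∀ k ∈ Finset.range (m + 1),
          (1 : ℝ) / k.factorial * iteratedDeriv k (L1fun n t ξ) 0 * ‖ξ‖ ^ k =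
          ((k.factorial : ℝ)⁻¹ * ‖ξ‖ ^ k) •
            iteratedDerivWithin k (L1fun n t ξ) (Set.Icc 0 1) 0 := by
        intro k _
        rw [iteratedDerivWithin_eq_iteratedDeriv (uniqueDiffOn_Icc zero_lt_one)
          (contDiffAt_L1fun n t ξ (by norm_num)) (by simp), smul_eq_mul]
        ring
      rw [Finset.sum_congr rfl heq]
      refine h.trans (div_le_self (by positivity) ?_)
      exact_mod_cast Nat.one_le_iff_ne_zero.2 (Nat.factorial_ne_zero m)
  have hfac : E1 n t ξ - ∑ k ∈ Finset.range M, e1 n k t ξ =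
      Real.exp (-(t * ‖ξ‖ ^ 2) / 2) * (L1fun n t ξ ‖ξ‖ - ∑ k ∈ Finset.range M,
        (1 : ℝ) / k.factorial * iteratedDeriv k (L1fun n t ξ) 0 * ‖ξ‖ ^ k) := by
    rw [E1_eq_exp_mul_L1fun n t (hξ.trans one_le_two), mul_sub, Finset.mul_sum]
    congr 1
    refine Finset.sum_congr rfl fun k _ => ?_
    rw [e1]
    ring
  rw [hfac, abs_mul, Real.abs_exp]
  calc _ ≤ Real.exp (-(t * ‖ξ‖ ^ 2) / 2) *
        (‖ξ‖⁻¹ * (C₁ * (1 + t * ‖ξ‖ ^ 2) ^ M) * ‖ξ‖ ^ M) := by gcongr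
    _ = ‖ξ‖⁻¹ * C₁ * ‖ξ‖ ^ M *
        (Real.exp (-(t * ‖ξ‖ ^ 2) / 2) * (1 + t * ‖ξ‖ ^ 2) ^ M) := by ring
    _ ≤ ‖ξ‖⁻¹ * C₁ * ‖ξ‖ ^ M * (C₂ * Real.exp (-(t * ‖ξ‖ ^ 2) / 4)) := by
        exact mul_le_mul_of_nonneg_left (h₂ _ (by positivity)) (by positivity)
    _ = _ := by ring

lemma abs_sum_mul_le_norm_mul_norm (n : ℕ) (x ξ : Rn n) : |∑ i, x i * ξ i| ≤ ‖x‖ * ‖ξ‖ := by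
  have h := abs_real_inner_le_norm ξ x
  rw [PiLp.inner_apply] at h
  simpa [mul_comm] using h

lemma abs_monomial_le (n k : ℕ) (x : Rn n) (α : Fin n → ℕ) (hα : ∑ i, α i = k) :
    |∏ i, x i ^ α i| ≤ ‖x‖ ^ k := by
  rw [Finset.abs_prod, ← hα, ← Finset.prod_pow_eq_pow_sum]
  refine Finset.prod_le_prod (fun _ _ => abs_nonneg _) fun i _ => ?_
  rw [abs_pow]
  gcongr
  exact PiLp.norm_apply_le x i

lemma norm_pow_le_one_add_rpow {n k : ℕ} {γ : ℝ} (hk : (k : ℝ) ≤ γ) (x : Rn n) :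
    ‖x‖ ^ k ≤ (1 + ‖x‖) ^ γ := by
  have h0 := norm_nonneg x
  calc ‖x‖ ^ k ≤ (1 + ‖x‖) ^ k := by
        gcongr
        linarith
    _ = (1 + ‖x‖) ^ (k : ℝ) := (Real.rpow_natCast _ _).symm
    _ ≤ (1 + ‖x‖) ^ γ := Real.rpow_le_rpow_of_exponent_le (by linarith) hk

lemma wnorm_nonneg (n : ℕ) (γ : ℝ) (f : Rn n → ℝ) : 0 ≤ wnorm n γ f :=
  integral_nonneg fun x => by positivity

lemma MemL1w.integrable_mul {n : ℕ} {γ : ℝ} {f : Rn n → ℝ} (hf : MemL1w n γ f) {p : Rn n → ℝ}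
    (hp : Continuous p) (hle : ∀ x, |p x| ≤ (1 + ‖x‖) ^ γ) :
    Integrable (fun x => p x * f x) := by
  refine hf.2.mono' (hp.aestronglyMeasurable.mul hf.1.aestronglyMeasurable)
    (Eventually.of_forall fun x => ?_)
  rw [Real.norm_eq_abs, abs_mul]
  gcongr
  exact hle x

/-- The multinomial theorem, indexed as in the definition of `mom`. -/
lemma sum_filter_prod_eq_pow_div_factorial (n k : ℕ) (y : Fin n → ℂ) :
    ∑ α ∈ Finset.univ.filter (fun α : Fin n → Fin (k + 1) => ∑ i, (α i).val = k),
      (1 / ∏ i, ((α i).val.factorial : ℂ)) * ∏ i, y i ^ (α i).val =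
    (∑ i, y i) ^ k / (k.factorial : ℂ) := by
  rw [Finset.sum_pow_eq_sum_piAntidiag, Finset.sum_div]
  have hlt : ∀ β ∈ (Finset.univ : Finset (Fin n)).piAntidiag k, ∀ i, β i < k + 1 := by
    intro β hβ i
    rw [Finset.mem_piAntidiag] at hβ
    have := Finset.single_le_sum (f := β) (fun _ _ => Nat.zero_le _) (Finset.mem_univ i)
    exact Nat.lt_succ_iff.2 (this.trans hβ.1.le)
  refine Finset.sum_bij' (fun α _ i => (α i).val) (fun β hβ i => ⟨β i, hlt β hβ i⟩)
    ?_ ?_ ?_ ?_ ?_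
  · intro α hα
    rw [Finset.mem_piAntidiag]
    exact ⟨(Finset.mem_filter.1 hα).2, fun _ _ => Finset.mem_univ _⟩
  · intro β hβ
    rw [Finset.mem_filter]
    exact ⟨Finset.mem_univ _, (Finset.mem_piAntidiag.1 hβ).1⟩
  · intro α hα
    rfl
  · intro β hβ
    rfl
  · intro α hα
    have hspec := Nat.multinomial_spec Finset.univ (fun i => (α i).val)
    rw [(Finset.mem_filter.1 hα).2] at hspec
    have hspec' : (∏ i, ((α i).val.factorial : ℂ)) *
        (Nat.multinomial Finset.univ (fun i => (α i).val) : ℂ) = (k.factorial : ℂ) := by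
      exact_mod_cast hspec
    have h0 : (∏ i, ((α i).val.factorial : ℂ)) ≠ 0 :=
      Finset.prod_ne_zero_iff.2 fun i _ => by exact_mod_cast Nat.factorial_ne_zero _
    have h1 : (k.factorial : ℂ) ≠ 0 := by exact_mod_cast Nat.factorial_ne_zero _
    rw [eq_div_iff h1, ← hspec']
    field_simp

/-- The moment polynomials are the Taylor terms of the Fourier transform. -/
lemma mom_eq_integral {n : ℕ} {γ : ℝ} {f : Rn n → ℝ} (hf : MemL1w n γ f) {k : ℕ}
    (hk : (k : ℝ) ≤ γ) (ξ : Rn n) :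
    mom n f k ξ = ∫ x : Rn n,
      (-Complex.I * ((∑ i, x i * ξ i : ℝ) : ℂ)) ^ k / (k.factorial : ℂ) * (f x : ℂ) := by
  have hint : ∀ α ∈ Finset.univ.filter (fun α : Fin n → Fin (k + 1) => ∑ i, (α i).val = k),
      Integrable (fun x : Rn n => (∏ i, x i ^ (α i).val) * f x) := fun α hα =>
    hf.integrable_mul (by fun_prop) fun x =>
      (abs_monomial_le n k x _ (Finset.mem_filter.1 hα).2).trans (norm_pow_le_one_add_rpow hk x)
  rw [mom]
  simp_rw [← integral_complex_ofReal, ← integral_const_mul, ← integral_mul_const]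
  rw [← integral_finsetSum]
  · congr 1
    funext x
    have h := sum_filter_prod_eq_pow_div_factorial n k
      (fun i => -Complex.I * ((x i * ξ i : ℝ) : ℂ))
    rw [← Finset.mul_sum, ← Complex.ofReal_sum] at h
    rw [← h, Finset.sum_mul]
    refine Finset.sum_congr rfl fun α hα => ?_
    have hprod : ∏ i, (-Complex.I * ((x i * ξ i : ℝ) : ℂ)) ^ (α i).val =
        (-1) ^ k * (∏ i, (x i : ℂ) ^ (α i).val) *
          ∏ i, (Complex.I * (ξ i : ℂ)) ^ (α i).val := by
      have hneg : (-1 : ℂ) ^ k = ∏ i, (-1 : ℂ) ^ (α i).val := by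
        rw [Finset.prod_pow_eq_pow_sum, (Finset.mem_filter.1 hα).2]
      rw [hneg, ← Finset.prod_mul_distrib, ← Finset.prod_mul_distrib]
      refine Finset.prod_congr rfl fun i _ => ?_
      rw [← mul_pow, ← mul_pow]
      push_cast
      ring
    rw [hprod]
    push_cast
    ring
  · intro α hα
    exact (((hint α hα).ofReal).const_mul _).mul_const _

lemma norm_neg_I_mul_ofReal (s : ℝ) : ‖-Complex.I * (s : ℂ)‖ = |s| := by
  simp

lemma norm_pow_div_factorial_le (s : ℝ) (k : ℕ) :
    ‖(-Complex.I * (s : ℂ)) ^ k / (k.factorial : ℂ)‖ ≤ |s| ^ k := by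
  rw [norm_div, norm_pow, norm_neg_I_mul_ofReal, Complex.norm_natCast]
  refine div_le_self (by positivity) ?_
  exact_mod_cast Nat.one_le_iff_ne_zero.2 (Nat.factorial_ne_zero k)

lemma norm_exp_neg_I_mul_ofReal (s : ℝ) : ‖Complex.exp (-Complex.I * (s : ℂ))‖ = 1 := by
  simp [Complex.norm_exp]

lemma norm_mom_le {n : ℕ} {γ : ℝ} {f : Rn n → ℝ} (hf : MemL1w n γ f) {k : ℕ}
    (hk : (k : ℝ) ≤ γ) (ξ : Rn n) : ‖mom n f k ξ‖ ≤ ‖ξ‖ ^ k * wnorm n γ f := by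
  rw [mom_eq_integral hf hk, wnorm, ← integral_const_mul]
  refine norm_integral_le_of_norm_le (hf.2.const_mul _) (Eventually.of_forall fun x => ?_)
  rw [norm_mul, Complex.norm_real, Real.norm_eq_abs, ← mul_assoc]
  gcongr
  calc _ ≤ |∑ i, x i * ξ i| ^ k := norm_pow_div_factorial_le _ _
    _ ≤ (‖x‖ * ‖ξ‖) ^ k := by
        gcongr
        exact abs_sum_mul_le_norm_mul_norm n x ξ
    _ = ‖ξ‖ ^ k * ‖x‖ ^ k := by ring
    _ ≤ ‖ξ‖ ^ k * (1 + ‖x‖) ^ γ := by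
        gcongr
        exact norm_pow_le_one_add_rpow hk x

/-- Taylor remainder of `e^{-is}` with a fractional exponent. -/
lemma norm_exp_sub_sum_le_rpow {γ : ℝ} {N : ℕ} (h1 : (N : ℝ) ≤ γ) (h2 : γ ≤ N + 1) (s : ℝ) :
    ‖Complex.exp (-Complex.I * (s : ℂ)) -
      ∑ k ∈ Finset.range (N + 1), (-Complex.I * (s : ℂ)) ^ k / (k.factorial : ℂ)‖ ≤
    (Real.exp 1 + N + 2) * |s| ^ γ := by
  have he := Real.exp_pos 1
  rcases le_total |s| 1 with hs | hs
  · have h := Complex.norm_exp_sub_sum_le_norm_mul_exp (-Complex.I * (s : ℂ)) (N + 1)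
    rw [norm_neg_I_mul_ofReal] at h
    have hpow : |s| ^ (N + 1) ≤ |s| ^ γ := by
      rcases (abs_nonneg s).eq_or_lt with h0 | h0
      · rw [← h0, zero_pow (by omega)]
        positivity
      · rw [← Real.rpow_natCast]
        exact Real.rpow_le_rpow_of_exponent_ge h0 hs (by exact_mod_cast h2)
    calc _ ≤ |s| ^ (N + 1) * Real.exp |s| := h
      _ ≤ |s| ^ γ * Real.exp 1 := by gcongr
      _ ≤ (Real.exp 1 + N + 2) * |s| ^ γ := by
          rw [mul_comm]
          gcongr
          have : (0 : ℝ) ≤ N := by positivity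
          linarith
  · have hpow : ∀ k ∈ Finset.range (N + 1), |s| ^ k ≤ |s| ^ γ := by
      intro k hk
      rw [← Real.rpow_natCast]
      refine Real.rpow_le_rpow_of_exponent_le hs (le_trans ?_ h1)
      exact_mod_cast Nat.lt_succ_iff.1 (Finset.mem_range.1 hk)
    have hone : 1 ≤ |s| ^ γ := by simpa using hpow 0 (by simp)
    calc _ ≤ 1 + ∑ k ∈ Finset.range (N + 1), |s| ^ γ := by
          refine (norm_sub_le _ _).trans (add_le_add (norm_exp_neg_I_mul_ofReal s).le ?_)
          exact norm_sum_le_of_le _ fun k hk => (norm_pow_div_factorial_le s k).trans (hpow k hk)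
      _ = 1 + (N + 1) * |s| ^ γ := by simp
      _ ≤ (Real.exp 1 + N + 2) * |s| ^ γ := by
          have : 0 ≤ Real.exp 1 * |s| ^ γ := by positivity
          linarith

lemma norm_fourierHat_sub_sum_mom_le {n : ℕ} {γ : ℝ} (hγ : 0 ≤ γ) {f : Rn n → ℝ}
    (hf : MemL1w n γ f) (ξ : Rn n) :
    ‖fourierHat n f ξ - ∑ j ∈ Finset.range (⌊γ⌋₊ + 1), mom n f j ξ‖ ≤
      (Real.exp 1 + ⌊γ⌋₊ + 2) * ‖ξ‖ ^ γ * wnorm n γ f := by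
  have hN : (⌊γ⌋₊ : ℝ) ≤ γ := Nat.floor_le hγ
  have hj : ∀ j ∈ Finset.range (⌊γ⌋₊ + 1), (j : ℝ) ≤ γ := fun j hj =>
    le_trans (by exact_mod_cast Nat.lt_succ_iff.1 (Finset.mem_range.1 hj)) hN
  have hcont : Continuous fun x : Rn n => -Complex.I * ((∑ i, x i * ξ i : ℝ) : ℂ) := by fun_prop
  have hint : ∀ j ∈ Finset.range (⌊γ⌋₊ + 1), Integrable fun x : Rn n =>
      (-Complex.I * ((∑ i, x i * ξ i : ℝ) : ℂ)) ^ j / (j.factorial : ℂ) * (f x : ℂ) := by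
    intro j hj'
    refine (hf.2.const_mul (‖ξ‖ ^ j)).mono'
      (((hcont.pow j).div_const _).aestronglyMeasurable.mul hf.1.ofReal.aestronglyMeasurable)
      (Eventually.of_forall fun x => ?_)
    rw [norm_mul, Complex.norm_real, Real.norm_eq_abs, ← mul_assoc]
    gcongr
    calc _ ≤ |∑ i, x i * ξ i| ^ j := norm_pow_div_factorial_le _ _
      _ ≤ (‖x‖ * ‖ξ‖) ^ j := by
          gcongr
          exact abs_sum_mul_le_norm_mul_norm n x ξ
      _ = ‖ξ‖ ^ j * ‖x‖ ^ j := by ring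
      _ ≤ ‖ξ‖ ^ j * (1 + ‖x‖) ^ γ := by
          gcongr
          exact norm_pow_le_one_add_rpow (hj j hj') x
  have hexp : Integrable fun x : Rn n =>
      Complex.exp (-Complex.I * ((∑ i, x i * ξ i : ℝ) : ℂ)) * (f x : ℂ) := by
    refine hf.1.ofReal.bdd_mul (c := 1) hcont.cexp.aestronglyMeasurable
      (Eventually.of_forall fun x => ?_)
    exact (norm_exp_neg_I_mul_ofReal _).le
  rw [fourierHat, Finset.sum_congr rfl fun j hj' => mom_eq_integral hf (hj j hj') ξ,
    ← integral_finsetSum _ hint, ← integral_sub hexp (integrable_finsetSum _ hint),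
    wnorm, ← integral_const_mul]
  refine norm_integral_le_of_norm_le (hf.2.const_mul _) (Eventually.of_forall fun x => ?_)
  rw [← Finset.sum_mul, ← sub_mul, norm_mul, Complex.norm_real, Real.norm_eq_abs, ← mul_assoc]
  gcongr
  refine (norm_exp_sub_sum_le_rpow hN (Nat.lt_floor_add_one γ).le _).trans ?_
  rw [mul_assoc]
  gcongr
  calc |∑ i, x i * ξ i| ^ γ ≤ (‖x‖ * ‖ξ‖) ^ γ := by
        gcongr
        exact abs_sum_mul_le_norm_mul_norm n x ξ
    _ = ‖ξ‖ ^ γ * ‖x‖ ^ γ := by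
        rw [Real.mul_rpow (norm_nonneg _) (norm_nonneg _), mul_comm]
    _ ≤ ‖ξ‖ ^ γ * (1 + ‖x‖) ^ γ := by
        gcongr
        linarith

lemma integrable_norm_rpow_mul_exp {n : ℕ} (hn : 1 ≤ n) {β : ℝ} (hβ : -(n : ℝ) < β) :
    Integrable (fun x : Rn n => ‖x‖ ^ β * Real.exp (-(1 / 2) * ‖x‖ ^ 2)) := by
  have : Nonempty (Fin n) := ⟨⟨0, hn⟩⟩
  rw [integrable_fun_norm_addHaar (volume : Measure (Rn n))
    (f := fun y : ℝ => y ^ β * Real.exp (-(1 / 2) * y ^ 2))]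
  refine (integrableOn_rpow_mul_exp_neg_mul_sq (b := 1 / 2) (by norm_num)
    (s := β + (n - 1 : ℕ)) ?_).congr_fun ?_ measurableSet_Ioi
  · rw [Nat.cast_sub hn]
    push_cast
    linarith
  · intro y hy
    simp only [finrank_euclideanSpace_fin, smul_eq_mul]
    rw [Real.rpow_add hy, Real.rpow_natCast]
    ring

/-- Decay of the low-frequency part of a heat kernel with a power weight. -/
lemma exists_integral_closedBall_exp_mul_rpow_le {n : ℕ} (hn : 1 ≤ n) {β : ℝ}
    (hβ : -(n : ℝ) < β) :
    ∃ C : ℝ, 0 ≤ C ∧ ∀ t : ℝ, 0 ≤ t →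
      IntegrableOn (fun x : Rn n => Real.exp (-(t * ‖x‖ ^ 2) / 2) * ‖x‖ ^ β)
        (Metric.closedBall 0 1) ∧
      ∫ x in Metric.closedBall (0 : Rn n) 1, Real.exp (-(t * ‖x‖ ^ 2) / 2) * ‖x‖ ^ β ≤
        C * (1 + t) ^ (-((n : ℝ) + β) / 2) := by
  set h : Rn n → ℝ := fun x => ‖x‖ ^ β * Real.exp (-(1 / 2) * ‖x‖ ^ 2) with hh
  have hint : Integrable h := integrable_norm_rpow_mul_exp hn hβ
  have hpos : ∀ x, 0 ≤ h x := fun x => by positivity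
  refine ⟨Real.exp (1 / 2) * ∫ x, h x, mul_nonneg (by positivity) (integral_nonneg hpos),
    fun t ht => ?_⟩
  set R : ℝ := Real.sqrt (1 + t) with hR
  have hR0 : 0 < R := Real.sqrt_pos.2 (by linarith)
  have hRsq : R ^ 2 = 1 + t := Real.sq_sqrt (by linarith)
  have hintR : Integrable fun x : Rn n => Real.exp (1 / 2) * R ^ (-β) * h (R • x) :=
    (hint.comp_smul hR0.ne').const_mul _
  have hle : ∀ x ∈ Metric.closedBall (0 : Rn n) 1,
      Real.exp (-(t * ‖x‖ ^ 2) / 2) * ‖x‖ ^ β ≤ Real.exp (1 / 2) * R ^ (-β) * h (R • x) := by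
    intro x hx
    have hx1 : ‖x‖ ≤ 1 := by simpa using hx
    have hx2 : ‖x‖ ^ 2 ≤ 1 := pow_le_one₀ (norm_nonneg x) hx1
    simp only [hh]
    rw [norm_smul, Real.norm_of_nonneg hR0.le, Real.mul_rpow hR0.le (norm_nonneg x), mul_pow, hRsq,
      show Real.exp (1 / 2) * R ^ (-β) *
        (R ^ β * ‖x‖ ^ β * Real.exp (-(1 / 2) * ((1 + t) * ‖x‖ ^ 2))) =
        (R ^ (-β) * R ^ β) * (Real.exp (1 / 2) * Real.exp (-(1 / 2) * ((1 + t) * ‖x‖ ^ 2))) *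
          ‖x‖ ^ β by ring, ← Real.rpow_add hR0, neg_add_cancel, Real.rpow_zero, one_mul,
      ← Real.exp_add]
    gcongr
    linarith
  refine ⟨hintR.integrableOn.mono' (by fun_prop) ?_, ?_⟩
  · filter_upwards [ae_restrict_mem measurableSet_closedBall] with x hx
    rw [Real.norm_of_nonneg (by positivity)]
    exact hle x hx
  · calc _ ≤ ∫ x in Metric.closedBall (0 : Rn n) 1, Real.exp (1 / 2) * R ^ (-β) * h (R • x) := by
          refine integral_mono_of_nonneg (Eventually.of_forall fun x => by positivity)
            hintR.integrableOn ?_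
          filter_upwards [ae_restrict_mem measurableSet_closedBall] with x hx using hle x hx
      _ ≤ ∫ x, Real.exp (1 / 2) * R ^ (-β) * h (R • x) :=
          setIntegral_le_integral hintR (Eventually.of_forall fun x => by
            have := hpos (R • x)
            positivity)
      _ = Real.exp (1 / 2) * (∫ x, h x) * R ^ (-((n : ℝ) + β)) := by
          rw [integral_const_mul, Measure.integral_comp_smul, finrank_euclideanSpace_fin,
            abs_of_pos (by positivity), smul_eq_mul, neg_add, Real.rpow_add hR0,
            Real.rpow_neg hR0.le (n : ℝ), Real.rpow_natCast]
          ring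
      _ = _ := by
          rw [hR, Real.sqrt_eq_rpow, ← Real.rpow_mul (by linarith)]
          ring_nf

lemma exists_norm_profile_remainder_le {γ : ℝ} (hγ : 0 ≤ γ) :
    ∃ K : ℝ, 0 ≤ K ∧ ∀ (n : ℕ) (f : Rn n → ℝ), MemL1w n γ f → ∀ t : ℝ, 0 ≤ t →
      ∀ ξ : Rn n, ‖ξ‖ ≤ 1 →
        ‖(E1 n t ξ : ℂ) * fourierHat n f ξ -
            ∑ k ∈ Finset.range (⌊γ⌋₊ + 1), (e1 n k t ξ : ℂ) *
              ∑ j ∈ Finset.range (⌊γ⌋₊ - k + 1), mom n f j ξ‖ ≤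
          K * wnorm n γ f * (Real.exp (-(t * ‖ξ‖ ^ 2) / 4) * (‖ξ‖ ^ γ * ‖ξ‖⁻¹)) := by
  choose C hC hE using exists_abs_E1_sub_sum_e1_le
  set N := ⌊γ⌋₊ with hN
  have hNγ : (N : ℝ) ≤ γ := Nat.floor_le hγ
  refine ⟨C 0 * (Real.exp 1 + N + 2) + ∑ j ∈ Finset.range (N + 1), C (N + 1 - j),
    add_nonneg (mul_nonneg (hC 0) (by positivity)) (Finset.sum_nonneg fun j _ => hC _),
    fun n f hf t ht ξ hξ => ?_⟩
  have hsplit : (E1 n t ξ : ℂ) * fourierHat n f ξ -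
      ∑ k ∈ Finset.range (N + 1), (e1 n k t ξ : ℂ) *
        ∑ j ∈ Finset.range (N - k + 1), mom n f j ξ =
      (E1 n t ξ : ℂ) * (fourierHat n f ξ - ∑ j ∈ Finset.range (N + 1), mom n f j ξ) +
      ∑ j ∈ Finset.range (N + 1), mom n f j ξ *
        ((E1 n t ξ - ∑ k ∈ Finset.range (N + 1 - j), e1 n k t ξ : ℝ) : ℂ) := by
    have hswap : ∑ k ∈ Finset.range (N + 1), (e1 n k t ξ : ℂ) *
        ∑ j ∈ Finset.range (N - k + 1), mom n f j ξ =
        ∑ j ∈ Finset.range (N + 1), mom n f j ξ *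
          ∑ k ∈ Finset.range (N + 1 - j), (e1 n k t ξ : ℂ) := by
      simp_rw [Finset.mul_sum]
      rw [Finset.sum_comm' (t' := Finset.range (N + 1))
        (s' := fun j => Finset.range (N + 1 - j))]
      · simp_rw [mul_comm]
      · intro k j
        simp only [Finset.mem_range]
        omega
    rw [hswap]
    push_cast
    simp_rw [mul_sub, Finset.sum_sub_distrib]
    rw [Finset.mul_sum]
    simp_rw [mul_comm (E1 n t ξ : ℂ)]
    ring
  have hW := wnorm_nonneg n γ f
  have hpow : ‖ξ‖ ^ (N + 1) ≤ ‖ξ‖ ^ γ := by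
    rcases (norm_nonneg ξ).eq_or_lt with h0 | h0
    · rw [← h0, zero_pow (by omega)]
      positivity
    · rw [← Real.rpow_natCast]
      refine Real.rpow_le_rpow_of_exponent_ge h0 hξ ?_
      exact_mod_cast (Nat.lt_floor_add_one γ).le
  rw [hsplit, add_mul, add_mul, Finset.sum_mul, Finset.sum_mul]
  refine (norm_add_le _ _).trans (add_le_add ?_ (norm_sum_le_of_le _ fun j hj => ?_))
  · have h0 := hE 0 n t ht ξ hξ
    rw [Finset.sum_range_zero, sub_zero, pow_zero, mul_one] at h0
    rw [norm_mul, Complex.norm_real, Real.norm_eq_abs]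
    calc _ ≤ C 0 * Real.exp (-(t * ‖ξ‖ ^ 2) / 4) * ‖ξ‖⁻¹ *
          ((Real.exp 1 + N + 2) * ‖ξ‖ ^ γ * wnorm n γ f) :=
          mul_le_mul h0 (norm_fourierHat_sub_sum_mom_le hγ hf ξ) (norm_nonneg _)
            ((abs_nonneg _).trans h0)
      _ = _ := by ring
  · have hjN : j ≤ N := Nat.lt_succ_iff.1 (Finset.mem_range.1 hj)
    have h0 := hE (N + 1 - j) n t ht ξ hξ
    have hm := norm_mom_le hf (le_trans (by exact_mod_cast hjN) hNγ) ξ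
    rw [norm_mul, Complex.norm_real, Real.norm_eq_abs]
    calc _ ≤ (‖ξ‖ ^ j * wnorm n γ f) *
          (C (N + 1 - j) * Real.exp (-(t * ‖ξ‖ ^ 2) / 4) * ‖ξ‖ ^ (N + 1 - j) * ‖ξ‖⁻¹) :=
          mul_le_mul hm h0 (abs_nonneg _) ((norm_nonneg _).trans hm)
      _ = C (N + 1 - j) * wnorm n γ f * (Real.exp (-(t * ‖ξ‖ ^ 2) / 4) *
          ((‖ξ‖ ^ j * ‖ξ‖ ^ (N + 1 - j)) * ‖ξ‖⁻¹)) := by ring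
      _ ≤ _ := by
          rw [← pow_add, Nat.add_sub_cancel' (hjN.trans N.le_succ)]
          have := hC (N + 1 - j)
          gcongr

theorem stmt0 (n : ℕ) (hn : 1 ≤ n) (γ : ℝ)
    (hγ1 : n = 1 → 1 / 2 < γ) (hγ2 : n = 2 → 0 < γ) (hγ3 : 3 ≤ n → 0 ≤ γ) :
    ∃ C : ℝ, 0 < C ∧ ∀ u₁ : Rn n → ℝ, MemL1w n γ u₁ → ∀ t : ℝ, 0 < t →
      Real.sqrt (∫ ξ in Metric.closedBall (0 : Rn n) 1,
          ‖(E1 n t ξ : ℂ) * fourierHat n u₁ ξ -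
            ∑ k ∈ Finset.range (⌊γ⌋₊ + 1), (e1 n k t ξ : ℂ) *
              ∑ j ∈ Finset.range (⌊γ⌋₊ - k + 1), mom n u₁ j ξ‖ ^ 2) ≤
        C * wnorm n γ u₁ * (1 + t) ^ (-(n : ℝ) / 4 - γ / 2 + 1 / 2) := by
  have hγ : 0 ≤ γ ∧ -(n : ℝ) < 2 * γ - 2 := by
    rcases (by omega : n = 1 ∨ n = 2 ∨ 3 ≤ n) with h | h | h
    · have := hγ1 h
      subst h
      constructor <;> push_cast <;> linarith
    · have := hγ2 h
      subst h
      constructor <;> push_cast <;> linarith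
    · have := hγ3 h
      have h3 : (3 : ℝ) ≤ n := by exact_mod_cast h
      constructor <;> linarith
  obtain ⟨K, hK, hbound⟩ := exists_norm_profile_remainder_le hγ.1
  obtain ⟨D, hD, hdecay⟩ := exists_integral_closedBall_exp_mul_rpow_le hn hγ.2
  refine ⟨K * Real.sqrt D + 1, by positivity, fun u₁ hu t ht => ?_⟩
  obtain ⟨hint, hle⟩ := hdecay t ht.le
  have hW := wnorm_nonneg n γ u₁
  refine (Real.sqrt_le_sqrt (y := (K * Real.sqrt D * wnorm n γ u₁ *
    (1 + t) ^ (-(n : ℝ) / 4 - γ / 2 + 1 / 2)) ^ 2) ?_).trans ?_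
  · calc _ ≤ ∫ ξ in Metric.closedBall (0 : Rn n) 1, (K * wnorm n γ u₁) ^ 2 *
          (Real.exp (-(t * ‖ξ‖ ^ 2) / 2) * ‖ξ‖ ^ (2 * γ - 2)) := by
          refine integral_mono_of_nonneg (Eventually.of_forall fun ξ => by positivity)
            (hint.const_mul _) ?_
          filter_upwards [ae_restrict_mem measurableSet_closedBall] with ξ hξ
          refine (pow_le_pow_left₀ (norm_nonneg _)
            (hbound n u₁ hu t ht.le ξ (by simpa using hξ)) 2).trans ?_
          rw [mul_pow _ (Real.exp _ * _), mul_pow (Real.exp _), ← Real.exp_nat_mul]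
          have hexp : ((2 : ℕ) : ℝ) * (-(t * ‖ξ‖ ^ 2) / 4) = -(t * ‖ξ‖ ^ 2) / 2 := by
            push_cast
            ring
          rw [hexp]
          gcongr
          rcases (norm_nonneg ξ).eq_or_lt with h0 | h0
          · rw [← h0, inv_zero, mul_zero, zero_pow two_ne_zero]
            positivity
          · rw [← Real.rpow_neg_one, ← Real.rpow_add h0, ← Real.rpow_mul_natCast h0.le]
            refine le_of_eq ?_
            congr 1
            push_cast
            ring
      _ ≤ (K * wnorm n γ u₁) ^ 2 * (D * (1 + t) ^ (-((n : ℝ) + (2 * γ - 2)) / 2)) := by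
          rw [integral_const_mul]
          gcongr
      _ = _ := by
          have hexp : -((n : ℝ) + (2 * γ - 2)) / 2 =
              (-(n : ℝ) / 4 - γ / 2 + 1 / 2) * ((2 : ℕ) : ℝ) := by
            push_cast
            ring
          rw [hexp, Real.rpow_mul_natCast (by linarith)]
          nth_rewrite 1 [← Real.sq_sqrt hD]
          ring
  · rw [Real.sqrt_sq (by positivity)]
    gcongr
    linarith
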